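/- Let q̃ be a probability measure on ℝ with finite second moment, mean μ_{q̃}, variance σ²_{q̃}, and define c_{q̃} = ∫₀¹ F_{q̃}⁻¹(y) erf⁻¹(2y−1) dy. Then for any m' ∈ ℝ and S' > 0, W₂²(q̃, N(m', S')) = σ²_{q̃} + (μ_{q̃} − m')² + S' − 2 c_{q̃} √(2S'). -/

import Mathlib

open MeasureTheory ProbabilityTheory Set

/-- `Wpp p ξ ν` : the `p`-th power of the `L_p` Wasserstein distance, as the infimum
over couplings `π` of `ξ` and `ν` of `∫ |x - z|^p dπ(x, z)`. -/
noncomputable def Wpp (p : ℝ) (ξ ν : Measure ℝ) : ℝ :=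
  sInf {c : ℝ | ∃ π : Measure (ℝ × ℝ), IsProbabilityMeasure π ∧
    π.map Prod.fst = ξ ∧ π.map Prod.snd = ν ∧ c = ∫ z, |z.1 - z.2| ^ p ∂π}

/-- Quantile function: `F⁻¹(y) = inf {x : F(x) ≥ y}` where `F(x) = ξ((-∞, x])`. -/
noncomputable def quantile (ξ : Measure ℝ) (y : ℝ) : ℝ :=
  sInf {x : ℝ | y ≤ (ξ (Iic x)).toReal}

/-- The error function `erf(x) = (2/√π) ∫₀ˣ e^{-t²} dt`. -/
noncomputable def erf (x : ℝ) : ℝ :=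
  (2 / Real.sqrt Real.pi) * ∫ t in (0:ℝ)..x, Real.exp (-t ^ 2)

/-- The inverse error function. -/
noncomputable def erfinv : ℝ → ℝ := Function.invFun erf

lemma q_galois (ξ : Measure ℝ) [IsProbabilityMeasure ξ] (y : ℝ) (hy : y ∈ Ioo (0:ℝ) 1) (x : ℝ) :
    quantile ξ y ≤ x ↔ y ≤ (ξ (Iic x)).toReal := by
  have hc : ∀ x, (ξ (Iic x)).toReal = cdf ξ x := fun x => by
    rw [cdf_eq_real]; rfl
  unfold quantile
  simp only [hc]
  set A := {x : ℝ | y ≤ cdf ξ x} with hA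
  have hne : A.Nonempty := by
    have := (tendsto_cdf_atTop ξ).eventually (lt_mem_nhds hy.2)
    obtain ⟨a, ha⟩ := this.exists
    exact ⟨a, ha.le⟩
  have hbd : BddBelow A := by
    have := (tendsto_cdf_atBot ξ).eventually (gt_mem_nhds hy.1)
    obtain ⟨a, ha⟩ := this.exists
    refine ⟨a, fun z hz => ?_⟩
    by_contra h
    have h1 := monotone_cdf ξ (not_le.1 h).le
    have h2 : y ≤ cdf ξ z := hz
    linarith
  constructor
  · intro h
    have key : ∀ z, x < z → y ≤ cdf ξ z := by
      intro z hz
      obtain ⟨a, ha, haz⟩ := exists_lt_of_csInf_lt hne (lt_of_le_of_lt h hz)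
      exact le_trans ha (monotone_cdf ξ haz.le)
    have hr : Filter.Tendsto (cdf ξ) (nhdsWithin x (Ioi x)) (nhds (cdf ξ x)) :=
      ((cdf ξ).right_continuous x).tendsto.mono_left (nhdsWithin_mono x Ioi_subset_Ici_self)
    refine ge_of_tendsto hr ?_
    filter_upwards [self_mem_nhdsWithin] with z hz using key z hz
  · intro h
    exact csInf_le hbd h

lemma map_of_galois (ξ : Measure ℝ) [IsProbabilityMeasure ξ] (T : ℝ → ℝ)
    (hT : ∀ y ∈ Ioo (0:ℝ) 1, ∀ x, T y ≤ x ↔ y ≤ (ξ (Iic x)).toReal) :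
    AEMeasurable T (volume.restrict (Ioo (0:ℝ) 1)) ∧
      (volume.restrict (Ioo (0:ℝ) 1)).map T = ξ := by
  have hm : AEMeasurable T (volume.restrict (Ioo (0:ℝ) 1)) := by
    apply aemeasurable_restrict_of_monotoneOn measurableSet_Ioo
    intro a ha b hb hab
    rw [hT a ha]
    exact hab.trans ((hT b hb _).1 le_rfl)
  refine ⟨hm, ?_⟩
  have : IsFiniteMeasure ((volume.restrict (Ioo (0:ℝ) 1)).map T) := by
    infer_instance
  apply Measure.ext_of_Iic
  intro x
  rw [Measure.map_apply_of_aemeasurable hm measurableSet_Iic, Measure.restrict_apply' measurableSet_Ioo]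
  have h1 : T ⁻¹' Iic x ∩ Ioo 0 1 = Ioo 0 1 ∩ Iic (ξ (Iic x)).toReal := by
    ext y
    simp only [mem_inter_iff, mem_preimage, mem_Iic]
    constructor
    · rintro ⟨h, h'⟩; exact ⟨h', (hT y h' x).1 h⟩
    · rintro ⟨h', h⟩; exact ⟨(hT y h' x).2 h, h'⟩
  rw [h1]
  have hF1 : (ξ (Iic x)).toReal ≤ 1 := by
    exact measureReal_le_one
  have e : ξ (Iic x) = ENNReal.ofReal (ξ (Iic x)).toReal := by
    rw [ENNReal.ofReal_toReal (measure_ne_top _ _)]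
  conv_rhs => rw [e]
  apply le_antisymm
  · calc _ ≤ volume (Ioc 0 (ξ (Iic x)).toReal) := measure_mono (fun y (hy : y ∈ Ioo (0:ℝ) 1 ∩ Iic (ξ (Iic x)).toReal) => (⟨hy.1.1, hy.2⟩ : y ∈ Ioc 0 (ξ (Iic x)).toReal))
      _ = _ := by simp
  · calc ENNReal.ofReal (ξ (Iic x)).toReal = volume (Ioo 0 (ξ (Iic x)).toReal) := by simp
      _ ≤ _ := by
          apply measure_mono
          intro y hy
          exact ⟨⟨hy.1, hy.2.trans_le hF1⟩, hy.2.le⟩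

def AA : Set ((ℝ × ℝ) × (ℝ × ℝ)) :=
  {w | w.1.1 ≤ w.2.1 ∧ w.1.1 ≤ w.2.2 ∧ w.2.1 < w.1.2 ∧ w.2.2 < w.1.2}

def BB : Set ((ℝ × ℝ) × (ℝ × ℝ)) :=
  {w | w.1.2 ≤ w.2.1 ∧ w.1.2 ≤ w.2.2 ∧ w.2.1 < w.1.1 ∧ w.2.2 < w.1.1}

lemma measAA : MeasurableSet AA := by
  unfold AA
  measurability

lemma measBB : MeasurableSet BB := by
  unfold BB
  measurability

lemma cost_eq (π : Measure (ℝ × ℝ)) [IsProbabilityMeasure π] :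
    ∫⁻ z, ENNReal.ofReal ((z.1 - z.2) ^ 2) ∂π =
      (∫⁻ p : ℝ × ℝ, π ((fun x => (x, p)) ⁻¹' AA)) + ∫⁻ p : ℝ × ℝ, π ((fun x => (x, p)) ⁻¹' BB) := by
  rw [← Measure.prod_apply_symm measAA, ← Measure.prod_apply_symm measBB,
    Measure.prod_apply measAA, Measure.prod_apply measBB, ← lintegral_add_left
      (measurable_measure_prodMk_left measAA)]
  congr 1
  ext z
  have hA : Prod.mk z ⁻¹' AA = Ico z.1 z.2 ×ˢ Ico z.1 z.2 := by
    ext p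
    simp only [AA, mem_preimage, mem_ofPred_eq, mem_prod, mem_Ico]
    tauto
  have hB : Prod.mk z ⁻¹' BB = Ico z.2 z.1 ×ˢ Ico z.2 z.1 := by
    ext p
    simp only [BB, mem_preimage, mem_ofPred_eq, mem_prod, mem_Ico]
    tauto
  rw [hA, hB, Measure.volume_eq_prod, Measure.prod_prod, Measure.prod_prod, Real.volume_Ico, Real.volume_Ico]
  rcases le_total z.1 z.2 with h | h
  · rw [ENNReal.ofReal_of_nonpos (by linarith : z.1 - z.2 ≤ 0),
      ← ENNReal.ofReal_mul (by linarith)]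
    simp only [mul_zero, add_zero]
    congr 1; ring
  · rw [ENNReal.ofReal_of_nonpos (by linarith : z.2 - z.1 ≤ 0),
      ← ENNReal.ofReal_mul (by linarith)]
    simp only [mul_zero, zero_add]
    congr 1; ring

lemma diff_bound {Ω : Type*} [MeasurableSpace Ω] (π : Measure Ω) [IsProbabilityMeasure π]
    (A B : Set Ω) :
    ENNReal.ofReal ((π A).toReal - (π B).toReal) ≤ π (A \ B) := by
  rw [ENNReal.ofReal_sub _ ENNReal.toReal_nonneg, ENNReal.ofReal_toReal (measure_ne_top _ _),
    ENNReal.ofReal_toReal (measure_ne_top _ _)]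
  exact le_measure_sdiff

lemma opt (ξ ν : Measure ℝ) [IsProbabilityMeasure ξ] [IsProbabilityMeasure ν] (Q G : ℝ → ℝ)
    (hQ : ∀ y ∈ Ioo (0:ℝ) 1, ∀ x, Q y ≤ x ↔ y ≤ (ξ (Iic x)).toReal)
    (hG : ∀ y ∈ Ioo (0:ℝ) 1, ∀ x, G y ≤ x ↔ y ≤ (ν (Iic x)).toReal)
    (π : Measure (ℝ × ℝ)) [IsProbabilityMeasure π]
    (h1 : π.map Prod.fst = ξ) (h2 : π.map Prod.snd = ν) :
    ∫⁻ z, ENNReal.ofReal ((z.1 - z.2) ^ 2)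
      ∂((volume.restrict (Ioo (0:ℝ) 1)).map (fun y => (Q y, G y))) ≤
    ∫⁻ z, ENNReal.ofReal ((z.1 - z.2) ^ 2) ∂π := by
  obtain ⟨hQm, hQmap⟩ := map_of_galois ξ Q hQ
  obtain ⟨hGm, hGmap⟩ := map_of_galois ν G hG
  have hm : AEMeasurable (fun y => (Q y, G y)) (volume.restrict (Ioo (0:ℝ) 1)) := hQm.prodMk hGm
  have : IsProbabilityMeasure (volume.restrict (Ioo (0:ℝ) 1)) := ⟨by simp⟩
  have := Measure.isProbabilityMeasure_map hm
  have e1 : ∀ s, ξ (Iic s) = π {z | z.1 ≤ s} := fun s => by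
    rw [← h1, Measure.map_apply measurable_fst measurableSet_Iic]; rfl
  have e2 : ∀ s, ν (Iic s) = π {z | z.2 ≤ s} := fun s => by
    rw [← h2, Measure.map_apply measurable_snd measurableSet_Iic]; rfl
  rw [cost_eq, cost_eq]
  refine add_le_add (lintegral_mono fun p => ?_) (lintegral_mono fun p => ?_)
  · rw [Measure.map_apply_of_aemeasurable hm (measurable_prodMk_right measAA), Measure.restrict_apply' measurableSet_Ioo]
    calc _ ≤ volume (Ioc (ν (Iic (max p.1 p.2))).toReal (ξ (Iic (min p.1 p.2))).toReal) := by
            apply measure_mono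
            rintro y ⟨hy, hy'⟩
            simp only [AA, mem_preimage, mem_ofPred_eq] at hy
            refine ⟨?_, (hQ y hy' _).1 (le_min hy.1 hy.2.1)⟩
            rw [← not_le, ← hG y hy', not_le]
            exact max_lt hy.2.2.1 hy.2.2.2
      _ = ENNReal.ofReal ((ξ (Iic (min p.1 p.2))).toReal - (ν (Iic (max p.1 p.2))).toReal) := by
            rw [Real.volume_Ioc]
      _ ≤ π ({z | z.1 ≤ min p.1 p.2} \ {z | z.2 ≤ max p.1 p.2}) := by
            rw [e1, e2]; exact diff_bound _ _ _
      _ ≤ _ := by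
            apply measure_mono
            rintro z ⟨hz, hz'⟩
            simp only [mem_ofPred_eq, not_le, le_min_iff, max_lt_iff] at hz hz'
            exact ⟨hz.1, hz.2, hz'.1, hz'.2⟩
  · rw [Measure.map_apply_of_aemeasurable hm (measurable_prodMk_right measBB), Measure.restrict_apply' measurableSet_Ioo]
    calc _ ≤ volume (Ioc (ξ (Iic (max p.1 p.2))).toReal (ν (Iic (min p.1 p.2))).toReal) := by
            apply measure_mono
            rintro y ⟨hy, hy'⟩
            simp only [BB, mem_preimage, mem_ofPred_eq] at hy
            refine ⟨?_, (hG y hy' _).1 (le_min hy.1 hy.2.1)⟩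
            rw [← not_le, ← hQ y hy', not_le]
            exact max_lt hy.2.2.1 hy.2.2.2
      _ = ENNReal.ofReal ((ν (Iic (min p.1 p.2))).toReal - (ξ (Iic (max p.1 p.2))).toReal) := by
            rw [Real.volume_Ioc]
      _ ≤ π ({z | z.2 ≤ min p.1 p.2} \ {z | z.1 ≤ max p.1 p.2}) := by
            rw [e1, e2]; exact diff_bound _ _ _
      _ ≤ _ := by
            apply measure_mono
            rintro z ⟨hz, hz'⟩
            simp only [mem_ofPred_eq, not_le, le_min_iff, max_lt_iff] at hz hz'
            exact ⟨hz.1, hz.2, hz'.1, hz'.2⟩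

lemma cexp : Continuous (fun t : ℝ => Real.exp (-t ^ 2)) := by fun_prop

lemma erf_sub (a b : ℝ) : erf b - erf a =
    (2 / Real.sqrt Real.pi) * ∫ t in a..b, Real.exp (-t ^ 2) := by
  unfold erf
  rw [← mul_sub, intervalIntegral.integral_interval_sub_left (cexp.intervalIntegrable _ _)
    (cexp.intervalIntegrable _ _)]

lemma erf_strictMono : StrictMono erf := by
  intro a b hab
  rw [← sub_pos, erf_sub]
  have : 0 < ∫ t in a..b, Real.exp (-t ^ 2) :=
    intervalIntegral.intervalIntegral_pos_of_pos (cexp.intervalIntegrable _ _)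
      (fun x => Real.exp_pos _) hab
  positivity

lemma erf_cont : Continuous erf := by
  unfold erf
  exact continuous_const.mul (intervalIntegral.continuous_primitive
    (fun a b => cexp.intervalIntegrable a b) 0)

lemma erf_neg (x : ℝ) : erf (-x) = - erf x := by
  unfold erf
  have := intervalIntegral.integral_comp_neg (a := 0) (b := x) (fun t : ℝ => Real.exp (-t ^ 2))
  simp only [neg_sq, neg_zero] at this
  rw [this, intervalIntegral.integral_symm]
  ring

lemma erf_top : Filter.Tendsto erf Filter.atTop (nhds 1) := by
  have hi : IntegrableOn (fun t : ℝ => Real.exp (-t ^ 2)) (Ioi 0) := by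
    have := (integrable_exp_neg_mul_sq (b := 1) one_pos).integrableOn (s := Ioi 0)
    simpa using this
  have h := intervalIntegral_tendsto_integral_Ioi 0 hi Filter.tendsto_id
  have hg := integral_gaussian_Ioi 1
  simp only [neg_mul, one_mul, div_one] at hg
  rw [hg] at h
  have := h.const_mul (2 / Real.sqrt Real.pi)
  have e : 2 / Real.sqrt Real.pi * (Real.sqrt Real.pi / 2) = 1 := by
    have : Real.sqrt Real.pi ≠ 0 := by positivity
    field_simp
  rw [e] at this
  exact this

lemma erf_bot : Filter.Tendsto erf Filter.atBot (nhds (-1)) := by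
  have := (erf_top.comp Filter.tendsto_neg_atBot_atTop).neg
  refine this.congr (fun x => ?_)
  simp [erf_neg]

lemma erf_erfinv (w : ℝ) (hw : w ∈ Ioo (-1:ℝ) 1) : erf (erfinv w) = w := by
  have : w ∈ range erf := by
    apply mem_range_of_exists_le_of_exists_ge erf_cont
    · obtain ⟨a, ha⟩ := (erf_bot.eventually (gt_mem_nhds hw.1)).exists
      exact ⟨a, ha.le⟩
    · obtain ⟨a, ha⟩ := (erf_top.eventually (lt_mem_nhds hw.2)).exists
      exact ⟨a, ha.le⟩
  exact Function.invFun_eq this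

lemma gauss_cdf (m S : ℝ) (hS : 0 < S) (x : ℝ) :
    (gaussianReal m S.toNNReal (Iic x)).toReal = (1 + erf ((x - m) / Real.sqrt (2 * S))) / 2 := by
  have hv : S.toNNReal ≠ 0 := by simpa using hS
  set r := Real.sqrt (2 * S) with hr
  have hrp : 0 < r := by positivity
  have hr2 : r ^ 2 = 2 * S := Real.sq_sqrt (by positivity)
  set ν := gaussianReal m S.toNNReal
  have hc : ∀ x, (ν (Iic x)).toReal = cdf ν x := fun x => by
    rw [cdf_eq_real]; rfl
  have key : ∀ a ≤ x, cdf ν x - cdf ν a = (erf ((x - m) / r) - erf ((a - m) / r)) / 2 := by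
    intro a ha
    have h1 : cdf ν x - cdf ν a = ∫ t in a..x, gaussianPDFReal m S.toNNReal t := by
      have : cdf ν x - cdf ν a = ν.real (Ioc a x) := by
        have hd : Ioc a x = Iic x \ Iic a := by
          ext t; simp [and_comm]
        rw [cdf_eq_real, cdf_eq_real, hd,
          measureReal_diff (Iic_subset_Iic.2 ha) measurableSet_Iic]
      rw [this, Measure.real, gaussianReal_apply_eq_integral m hv, ENNReal.toReal_ofReal
        (integral_nonneg (fun t => gaussianPDFReal_nonneg _ _ _)), intervalIntegral.integral_of_le ha]
    rw [h1, erf_sub]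
    have h2 := intervalIntegral.integral_comp_div (a := a - m) (b := x - m)
      (fun t : ℝ => Real.exp (-t ^ 2)) hrp.ne'
    have h3 := intervalIntegral.integral_comp_sub_right (a := a) (b := x)
      (fun t : ℝ => Real.exp (-(t / r) ^ 2)) m
    rw [h2] at h3
    have h4 : ∀ t, gaussianPDFReal m S.toNNReal t =
        (1 / (Real.sqrt Real.pi * r)) * Real.exp (-((t - m) / r) ^ 2) := by
      intro t
      rw [gaussianPDFReal, Real.coe_toNNReal _ hS.le, div_pow, hr2, hr,
        ← Real.sqrt_mul Real.pi_pos.le, one_div]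
      congr 2
      · congr 1; ring
      · ring
    simp_rw [h4]
    rw [intervalIntegral.integral_const_mul, h3, smul_eq_mul]
    have : Real.sqrt Real.pi ≠ 0 := by positivity
    field_simp
  have l1 : Filter.Tendsto (fun a => cdf ν x - cdf ν a) Filter.atBot (nhds (cdf ν x - 0)) :=
    tendsto_const_nhds.sub (tendsto_cdf_atBot ν)
  have l0 : Filter.Tendsto (fun a => (a - m) / r) Filter.atBot Filter.atBot :=
    (Filter.tendsto_atBot_add_const_right _ (-m) Filter.tendsto_id).atBot_div_const hrp
  have l2 : Filter.Tendsto (fun a => (erf ((x - m) / r) - erf ((a - m) / r)) / 2) Filter.atBot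
      (nhds ((erf ((x - m) / r) - (-1)) / 2)) :=
    (tendsto_const_nhds.sub (erf_bot.comp l0)).div_const 2
  have := tendsto_nhds_unique_of_eventuallyEq l1 l2 (by
    filter_upwards [Filter.eventually_le_atBot x] with a ha using key a ha)
  rw [hc]
  linarith

lemma g_galois (m S : ℝ) (hS : 0 < S) (y : ℝ) (hy : y ∈ Ioo (0:ℝ) 1) (x : ℝ) :
    m + Real.sqrt (2 * S) * erfinv (2 * y - 1) ≤ x ↔
      y ≤ (gaussianReal m S.toNNReal (Iic x)).toReal := by
  have hrp : 0 < Real.sqrt (2 * S) := by positivity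
  rw [gauss_cdf m S hS]
  have h := erf_erfinv (2 * y - 1) ⟨by linarith [hy.1], by linarith [hy.2]⟩
  have h2 := erf_strictMono.le_iff_le (a := erfinv (2 * y - 1)) (b := (x - m) / Real.sqrt (2 * S))
  rw [h, le_div_iff₀ hrp] at h2
  constructor
  · intro h3
    have := h2.2 (by linarith)
    linarith
  · intro h3
    have := h2.1 (by linarith)
    linarith

theorem stmt18 (qt : Measure ℝ) [IsProbabilityMeasure qt]
    (hmom : Integrable (fun x => x ^ 2) qt) (m' S' : ℝ) (hS' : 0 < S') :
    let μqt : ℝ := ∫ x, x ∂qt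
    let cqt : ℝ := ∫ y in (0:ℝ)..1, quantile qt y * erfinv (2 * y - 1)
    Wpp 2 qt (gaussianReal m' S'.toNNReal) =
      ProbabilityTheory.variance id qt + (μqt - m') ^ 2 + S'
        - 2 * cqt * Real.sqrt (2 * S') := by
  intro μqt cqt
  set ν := gaussianReal m' S'.toNNReal with hν
  set r := Real.sqrt (2 * S') with hr
  have hrp : 0 < r := by positivity
  set Q := quantile qt with hQdef
  set G : ℝ → ℝ := fun y => m' + r * erfinv (2 * y - 1) with hGdef
  set U := (volume : Measure ℝ).restrict (Ioo (0:ℝ) 1) with hU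
  have hQ := q_galois qt
  have hG : ∀ y ∈ Ioo (0:ℝ) 1, ∀ x, G y ≤ x ↔ y ≤ (ν (Iic x)).toReal := g_galois m' S' hS'
  obtain ⟨hQm, hQmap⟩ := map_of_galois qt Q hQ
  obtain ⟨hGm, hGmap⟩ := map_of_galois ν G hG
  have hm : AEMeasurable (fun y => (Q y, G y)) U := hQm.prodMk hGm
  have : IsProbabilityMeasure U := ⟨by simp [hU]⟩
  have hP := Measure.isProbabilityMeasure_map hm
  have mq : MemLp id 2 qt := (memLp_two_iff_integrable_sq aestronglyMeasurable_id).2 hmom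
  have mg : MemLp id 2 ν := memLp_id_gaussianReal 2
  have mQ : MemLp Q 2 U := by
    rw [← hQmap] at mq
    exact (memLp_map_measure_iff aestronglyMeasurable_id hQm).1 mq
  have mG : MemLp G 2 U := by
    rw [← hGmap] at mg
    exact (memLp_map_measure_iff aestronglyMeasurable_id hGm).1 mg
  have hpow : ∀ z : ℝ × ℝ, |z.1 - z.2| ^ (2:ℝ) = (z.1 - z.2) ^ 2 := fun z => by
    rw [Real.rpow_two, sq_abs]
  have hmeas : Measurable (fun z : ℝ × ℝ => (z.1 - z.2) ^ 2) := by fun_prop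
  have hleast : IsLeast {c : ℝ | ∃ π : Measure (ℝ × ℝ), IsProbabilityMeasure π ∧
      π.map Prod.fst = qt ∧ π.map Prod.snd = ν ∧ c = ∫ z, |z.1 - z.2| ^ (2:ℝ) ∂π}
      (∫ z, (z.1 - z.2) ^ 2 ∂(U.map (fun y => (Q y, G y)))) := by
    constructor
    · refine ⟨U.map (fun y => (Q y, G y)), hP, ?_, ?_, ?_⟩
      · rw [AEMeasurable.map_map_of_aemeasurable measurable_fst.aemeasurable hm]
        exact hQmap
      · rw [AEMeasurable.map_map_of_aemeasurable measurable_snd.aemeasurable hm]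
        exact hGmap
      · simp_rw [hpow]
    · rintro c ⟨π, hπ, h1, h2, rfl⟩
      simp_rw [hpow]
      have a1 : MemLp (fun z : ℝ × ℝ => z.1) 2 π := by
        rw [← h1] at mq
        exact (memLp_map_measure_iff aestronglyMeasurable_id measurable_fst.aemeasurable).1 mq
      have a2 : MemLp (fun z : ℝ × ℝ => z.2) 2 π := by
        rw [← h2] at mg
        exact (memLp_map_measure_iff aestronglyMeasurable_id measurable_snd.aemeasurable).1 mg
      have a3 : Integrable (fun z : ℝ × ℝ => (z.1 - z.2) ^ 2) π := (a1.sub a2).integrable_sq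
      rw [integral_eq_lintegral_of_nonneg_ae (Filter.Eventually.of_forall fun z => sq_nonneg _)
        hmeas.aestronglyMeasurable,
        integral_eq_lintegral_of_nonneg_ae (Filter.Eventually.of_forall fun z => sq_nonneg _)
        hmeas.aestronglyMeasurable]
      apply ENNReal.toReal_mono
      · exact a3.lintegral_lt_top.ne
      · exact opt qt ν Q G hQ hG π h1 h2
  have hW : Wpp 2 qt ν = ∫ z, (z.1 - z.2) ^ 2 ∂(U.map (fun y => (Q y, G y))) := hleast.csInf_eq
  rw [hW, integral_map hm hmeas.aestronglyMeasurable]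
  have iQ : ∫ y, Q y ∂U = μqt := by
    have := integral_map (f := id) hQm aestronglyMeasurable_id
    rw [hQmap] at this
    exact this.symm
  have iQ2 : ∫ y, Q y ^ 2 ∂U = variance id qt + μqt ^ 2 := by
    have := integral_map (f := fun x : ℝ => x ^ 2) hQm (by fun_prop)
    rw [hQmap] at this
    rw [← this, variance_eq_sub mq]
    simp [μqt]
  have iG2 : ∫ y, G y ^ 2 ∂U = S' + m' ^ 2 := by
    have := integral_map (f := fun x : ℝ => x ^ 2) hGm (by fun_prop)
    rw [hGmap] at this
    have v := variance_eq_sub mg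
    have v2 : variance id ν = S' := by
      rw [hν, variance_id_gaussianReal, Real.coe_toNNReal _ hS'.le]
    have v3 : ∫ x, x ∂ν = m' := integral_id_gaussianReal
    simp only [Pi.pow_apply, id] at v
    rw [← this]
    change variance id ν = _ at v
    rw [v2, v3] at v
    linarith
  have iQG : Integrable (fun y => Q y * G y) U := mQ.integrable_mul mG
  have iQ1 : Integrable Q U := mQ.integrable (by norm_num)
  have hc : cqt = ∫ y, Q y * erfinv (2 * y - 1) ∂U := by
    simp only [cqt]
    rw [intervalIntegral.integral_of_le zero_le_one, integral_Ioc_eq_integral_Ioo]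
  have hx : ∫ y, Q y * G y ∂U = m' * μqt + r * cqt := by
    have e : (fun y => Q y * erfinv (2 * y - 1)) = fun y => r⁻¹ * (Q y * G y - m' * Q y) := by
      ext y
      simp only [hGdef]
      field_simp
      ring
    rw [hc, e, integral_const_mul, integral_sub iQG (iQ1.const_mul _), integral_const_mul, iQ]
    field_simp
    ring
  have e : ∀ y, (Q y - G y) ^ 2 = (Q y ^ 2 + G y ^ 2) - 2 * (Q y * G y) := fun y => by ring
  simp_rw [e]
  have iS : Integrable (fun y => Q y ^ 2 + G y ^ 2) U := mQ.integrable_sq.add mG.integrable_sq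
  rw [integral_sub iS (iQG.const_mul 2),
    integral_add mQ.integrable_sq mG.integrable_sq, integral_const_mul, hx, iQ2, iG2]
  ring
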